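/- arXiv:math/0110214 — 4 statements merged into one kernel-verified Lean document; each statement's English description precedes it below -/
import Mathlib

section
/- Let E be a simple Edge Firing Game and let C and C' be two reachable configurations of E with C ≥ C'. If σ and σ' are two sequences of firings each of which transforms C into C', then the set of vertices fired during σ equals the set of vertices fired during σ'. (Lemma 1 of the paper.) -/
namespace EFG

variable {V : Type*}

/-- An orientation of the undirected graph `G`: for each edge `{u,v}` of `G`, exactly one
of the directions `u → v`, `v → u` is present, and there are no other arcs. -/
structure Orientation {V : Type*} (G : SimpleGraph V) where
  dir : V → V → Prop
  adj_of_dir : ∀ ⦃u v : V⦄, dir u v → G.Adj u v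
  dir_iff_not : ∀ ⦃u v : V⦄, G.Adj u v → (dir u v ↔ ¬ dir v u)

/-- In the EFG with sink `s`, the vertex `v` is firable in the configuration `C`:
`v` is not the sink and every edge incident to `v` is directed toward `v`. -/
def Firable {G : SimpleGraph V} (s : V) (C : Orientation G) (v : V) : Prop :=
  v ≠ s ∧ ∀ u : V, G.Adj u v → C.dir u v

/-- `C'` is obtained from `C` by firing the vertex `v`: `v` is firable in `C` and all
edges incident to `v` are reversed, all other edges keeping their orientation. -/
def Fires {G : SimpleGraph V} (s : V) (C : Orientation G) (v : V) (C' : Orientation G) : Prop :=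
  Firable s C v ∧
    (∀ a b : V, (a = v ∨ b = v) → (C'.dir a b ↔ C.dir b a)) ∧
    (∀ a b : V, a ≠ v → b ≠ v → (C'.dir a b ↔ C.dir a b))

/-- `FireSeq s C l C'`: the sequence of firings `l` transforms `C` into `C'`. -/
inductive FireSeq {G : SimpleGraph V} (s : V) : Orientation G → List V → Orientation G → Prop
  | nil (C : Orientation G) : FireSeq s C [] C
  | cons {C C' C'' : Orientation G} {v : V} {l : List V} :
      Fires s C v C' → FireSeq s C' l C'' → FireSeq s C (v :: l) C''

/-- `C` is reachable from the initial configuration `G₀`. -/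
def Reach {G : SimpleGraph V} (s : V) (G₀ C : Orientation G) : Prop :=
  ∃ l : List V, FireSeq s G₀ l C

/-- The EFG with sink `s` and initial configuration `G₀` is simple: in every sequence of
firings starting from `G₀`, each vertex is fired at most once. -/
def IsSimple {G : SimpleGraph V} (s : V) (G₀ : Orientation G) : Prop :=
  ∀ (l : List V) (C : Orientation G), FireSeq s G₀ l C → l.Nodup

/-- The configuration space of the EFG: reachable configurations,
ordered by `C ≤ C'` iff `C` can be obtained from `C'` by a sequence of firings. -/
def ConfigSpace (G : SimpleGraph V) (s : V) (G₀ : Orientation G) : Type _ :=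
  {C : Orientation G // Reach s G₀ C}

instance {G : SimpleGraph V} {s : V} {G₀ : Orientation G} : LE (ConfigSpace G s G₀) :=
  ⟨fun C C' => ∃ l : List V, FireSeq s C'.1 l C.1⟩


theorem FireSeq.append {G : SimpleGraph V} {s : V} {C C' C'' : Orientation G} {l l' : List V}
    (h : FireSeq s C l C') (h' : FireSeq s C' l' C'') : FireSeq s C (l ++ l') C'' := by
  induction h with
  | nil => exact h'
  | cons hf _ ih => exact .cons hf (ih h')

theorem FireSeq.sink_notMem {G : SimpleGraph V} {s : V} {C C' : Orientation G} {l : List V}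
    (h : FireSeq s C l C') : s ∉ l := by
  induction h with
  | nil => simp
  | cons hf _ ih => simpa using ⟨hf.1.1.symm, ih⟩

/-- Every firing of one of its endpoints reverses an edge, so its final direction is determined
by the parity of the number of such firings. -/
theorem FireSeq.dir_iff [DecidableEq V] {G : SimpleGraph V} {s : V} {C C' : Orientation G}
    {l : List V} (h : FireSeq s C l C') {u v : V} (huv : G.Adj u v) :
    C'.dir u v ↔ (C.dir u v ↔ Even (l.count u + l.count v)) := by
  induction h with
  | nil => simp
  | @cons C₁ C₂ C₃ w l hf _ ih =>
    have hne := huv.ne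
    have hflip := C₁.dir_iff_not huv
    rw [ih]
    by_cases hu : w = u
    · subst hu
      have hdir := hf.2.1 w v (Or.inl rfl)
      rw [List.count_cons_self, List.count_cons_of_ne hne, add_right_comm, Nat.even_add_one]
      tauto
    · by_cases hv : w = v
      · subst hv
        have hdir := hf.2.1 u w (Or.inr rfl)
        rw [List.count_cons_self, List.count_cons_of_ne hu, ← add_assoc, Nat.even_add_one]
        tauto
      · rw [List.count_cons_of_ne hu, List.count_cons_of_ne hv,
          hf.2.2 u v (Ne.symm hu) (Ne.symm hv)]

/-- Two firing sequences with the same endpoints fire every vertex the same number of times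
modulo two: this holds at the sink and propagates along edges. -/
theorem FireSeq.even_count_iff [DecidableEq V] {G : SimpleGraph V} (hconn : G.Connected) {s : V}
    {C C' : Orientation G} {l l' : List V} (h : FireSeq s C l C') (h' : FireSeq s C l' C')
    (v : V) : Even (l.count v) ↔ Even (l'.count v) := by
  have hreach := (SimpleGraph.reachable_iff_reflTransGen s v).1 (hconn.preconnected s v)
  induction hreach with
  | refl => simp [List.count_eq_zero_of_not_mem h.sink_notMem,
      List.count_eq_zero_of_not_mem h'.sink_notMem]
  | tail _ hadj ih =>
    have h₁ := h.dir_iff hadj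
    have h₂ := h'.dir_iff hadj
    rw [Nat.even_add] at h₁ h₂
    tauto

theorem IsSimple.nodup {G : SimpleGraph V} {s : V} {G₀ C C' : Orientation G} {l : List V}
    (hsimple : IsSimple s G₀) (hC : Reach s G₀ C) (h : FireSeq s C l C') : l.Nodup := by
  obtain ⟨l₀, h₀⟩ := hC
  exact (hsimple _ _ (h₀.append h)).of_append_right

/-- in a simple EFG, any two firing sequences transforming a reachable
configuration `C` into a reachable configuration `C'` fire the same set of vertices. -/
theorem fired_set_independent_of_sequence
    {V : Type*} [Fintype V] {G : SimpleGraph V} (hconn : G.Connected)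
    (s : V) (G₀ : Orientation G) (hsimple : IsSimple s G₀)
    (C C' : Orientation G) (hC : Reach s G₀ C) (hC' : Reach s G₀ C')
    (σ σ' : List V) (hσ : FireSeq s C σ C') (hσ' : FireSeq s C σ' C') :
    {v : V | v ∈ σ} = {v : V | v ∈ σ'} := by
  classical
  ext v
  have heven := hσ.even_count_iff hconn hσ' v
  rw [(hsimple.nodup hC hσ).count, (hsimple.nodup hC hσ').count] at heven
  by_cases hv : v ∈ σ <;> by_cases hv' : v ∈ σ' <;> simp_all

end EFG
end

section
/- Let an EFG be given and let σ be a sequence of firings transforming a configuration C into a configuration C' in which each vertex is fired at most once, and let S be the set of vertices fired during σ. Then: (i) every edge of G with both endpoints outside S has the same orientation in C and in C'; (ii) every edge of G with exactly one endpoint v in S is directed toward v in C and directed away from v in C'; (iii) every edge of G with both endpoints in S has the same orientation in C and in C'. -/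
namespace EFG

variable {V : Type*}

/-- if `σ` transforms `C` into `C'` firing each vertex at most once, with
`S` the set of fired vertices, then (i) edges with both endpoints outside `S` keep their
orientation, (ii) edges with exactly one endpoint `v` in `S` are directed toward `v` in
`C` and away from `v` in `C'`, (iii) edges with both endpoints in `S` keep their
orientation. -/
theorem edge_orientation_along_nodup_sequence
    {V : Type*} [Fintype V] {G : SimpleGraph V} (hconn : G.Connected)
    (s : V) (G₀ : Orientation G)
    (C C' : Orientation G) (σ : List V) (hσ : FireSeq s C σ C') (hnd : σ.Nodup) :
    (∀ u v : V, G.Adj u v → u ∉ σ → v ∉ σ → (C'.dir u v ↔ C.dir u v)) ∧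
    (∀ u v : V, G.Adj u v → u ∉ σ → v ∈ σ → (C.dir u v ∧ C'.dir v u)) ∧
    (∀ u v : V, G.Adj u v → u ∈ σ → v ∈ σ → (C'.dir u v ↔ C.dir u v)) := by
  clear hconn G₀
  induction hσ with
  | nil C => simp
  | @cons C C₁ C₂ w l hf _ ih =>
    obtain ⟨hw, hnd⟩ := List.nodup_cons.mp hnd
    obtain ⟨ih_out, ih_mixed, ih_in⟩ := ih hnd
    obtain ⟨⟨-, hin⟩, hrev, hkeep⟩ := hf
    refine ⟨fun u v huv hu hv => ?_, fun u v huv hu hv => ?_, fun u v huv hu hv => ?_⟩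
    · rw [List.mem_cons, not_or] at hu hv
      exact (ih_out u v huv hu.2 hv.2).trans (hkeep u v hu.1 hv.1)
    · rw [List.mem_cons, not_or] at hu
      rcases List.mem_cons.mp hv with rfl | hv
      · exact ⟨hin u huv,
          (ih_out v u huv.symm hw hu.2).mpr ((hrev v u (Or.inl rfl)).mpr (hin u huv))⟩
      · have hvw : v ≠ w := fun h => hw (h ▸ hv)
        exact ⟨(hkeep u v hu.1 hvw).mp (ih_mixed u v huv hu.2 hv).1,
          (ih_mixed u v huv hu.2 hv).2⟩
    · rcases List.mem_cons.mp hu with rfl | hul <;> rcases List.mem_cons.mp hv with rfl | hvl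
      · exact absurd huv G.irrefl
      · rw [C₂.dir_iff_not huv, C.dir_iff_not huv]
        exact not_congr (iff_of_true (ih_mixed u v huv hw hvl).2 (hin v huv.symm))
      · exact iff_of_true (ih_mixed v u huv.symm hw hul).2 (hin u huv)
      · exact (ih_in u v huv hul hvl).trans
          (hkeep u v (fun h => hw (h ▸ hul)) (fun h => hw (h ▸ hvl)))

end EFG
end

section
/- In any Edge Firing Game there is no loop in the configuration space: no nonempty sequence of firings transforms a configuration into itself. Consequently, the relation C ≥ C' defined by 'C' is obtainable from C by a (possibly empty) sequence of firings' is antisymmetric, hence a partial order on the set of reachable configurations. -/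
namespace EFG

variable {V : Type*}

open Classical in
/-- Along an edge `{u,v}`, firings of `u` and `v` alternate: the direction of the edge records
the difference between their numbers of firings. -/
theorem FireSeq.count_add_dir {G : SimpleGraph V} {s : V} {C C' : Orientation G} {l : List V}
    (h : FireSeq s C l C') {u v : V} (huv : G.Adj u v) :
    l.count u + (if C.dir u v then 1 else 0) = l.count v + (if C'.dir u v then 1 else 0) := by
  induction h with
  | nil => rfl
  | @cons C D C' x l hf _ ih =>
    obtain ⟨⟨-, hin⟩, hrev, hkeep⟩ := hf
    have hne := huv.ne
    have hC := C.dir_iff_not huv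
    by_cases hu : x = u
    · subst hu
      have hvu := hin v huv.symm
      have hD := hrev x v (.inl rfl)
      simp_all
    · by_cases hv : x = v
      · subst hv
        have hux := hin u huv
        have hD := hrev u x (.inr rfl)
        simp_all
        omega
      · have hD := hkeep u v (Ne.symm hu) (Ne.symm hv)
        simp_all

theorem FireSeq.eq_nil_of_loop {G : SimpleGraph V} (hconn : G.Connected) {s : V}
    {C : Orientation G} {l : List V} (h : FireSeq s C l C) : l = [] := by
  classical
  have hcount (u : V) : l.count u = l.count s := by
    obtain ⟨p⟩ := hconn.preconnected u s
    induction p with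
    | nil => rfl
    | cons huv _ ih => exact (Nat.add_right_cancel (h.count_add_dir huv)).trans (ih h)
  refine List.eq_nil_iff_forall_not_mem.2 fun u => ?_
  rw [← List.count_eq_zero, hcount, List.count_eq_zero]
  exact h.sink_notMem

/-- in any EFG, no nonempty sequence of firings transforms a configuration
into itself; consequently the relation "obtainable by a sequence of firings" is
antisymmetric on the reachable configurations. -/
theorem no_loop_in_configuration_space
    {V : Type*} [Fintype V] {G : SimpleGraph V} (hconn : G.Connected)
    (s : V) (G₀ : Orientation G) :
    (∀ (C : Orientation G) (l : List V), FireSeq s C l C → l = []) ∧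
    (∀ C C' : Orientation G, Reach s G₀ C → Reach s G₀ C' →
      (∃ l : List V, FireSeq s C l C') → (∃ l' : List V, FireSeq s C' l' C) → C = C') := by
  refine ⟨fun C l h => h.eq_nil_of_loop hconn, ?_⟩
  rintro C C' - - ⟨l, h⟩ ⟨l', h'⟩
  obtain ⟨rfl, -⟩ := List.append_eq_nil_iff.1 ((h.append h').eq_nil_of_loop hconn)
  cases h
  rfl

end EFG
end

section
/- The configuration space of any Edge Firing Game is order-isomorphic to the configuration space of some simple Edge Firing Game. (Corollary of the paper's main theorem combined with Propp's theorem that the configuration space of any EFG is a distributive lattice.) -/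
namespace EFG

variable {V : Type*}

open Classical in
/-- The orientation obtained from `C` by reversing all edges incident to `v`. -/
noncomputable def Orientation.reverseAt {G : SimpleGraph V} (C : Orientation G)
    (v : V) : Orientation G where
  dir a b := if a = v ∨ b = v then C.dir b a else C.dir a b
  adj_of_dir a b h := by
    split_ifs at h
    · exact (C.adj_of_dir h).symm
    · exact C.adj_of_dir h
  dir_iff_not a b h := by
    simp only [or_comm (a := b = v)]
    split_ifs
    · exact C.dir_iff_not h.symm
    · exact C.dir_iff_not h

theorem Firable.fires_reverseAt {G : SimpleGraph V} {s v : V} {C : Orientation G}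
    (h : Firable s C v) : Fires s C v (C.reverseAt v) := by
  refine ⟨h, fun a b hab => ?_, fun a b ha hb => ?_⟩
  · simp [Orientation.reverseAt, hab]
  · simp [Orientation.reverseAt, ha, hb]

theorem Orientation.ext_dir {G : SimpleGraph V} {C D : Orientation G}
    (h : ∀ a b, C.dir a b ↔ D.dir a b) : C = D := by
  cases C; cases D
  congr
  funext a b
  exact propext (h a b)

theorem Orientation.not_dir_symm {G : SimpleGraph V} (C : Orientation G) {a b : V}
    (h : C.dir a b) : ¬ C.dir b a :=
  (C.dir_iff_not (C.adj_of_dir h)).1 h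

theorem Orientation.dir_or_dir {G : SimpleGraph V} (C : Orientation G) {a b : V}
    (h : G.Adj a b) : C.dir a b ∨ C.dir b a := by
  have := C.dir_iff_not h
  tauto

/-- The firing counts `f` are compatible with the passage from `G₀` to `C`: the sink is never
fired, and the ends of each edge fire alternately. -/
def IsCount {G : SimpleGraph V} (s : V) (G₀ : Orientation G) (f : V → ℕ)
    (C : Orientation G) : Prop :=
  f s = 0 ∧ ∀ a b, G₀.dir a b → (f a = f b ∧ C.dir a b) ∨ (f b = f a + 1 ∧ C.dir b a)

namespace IsCount

variable {G : SimpleGraph V} {s : V} {G₀ C D : Orientation G} {f g : V → ℕ}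

theorem zero (s : V) (G₀ : Orientation G) : IsCount s G₀ 0 G₀ :=
  ⟨rfl, fun _ _ h => Or.inl ⟨rfl, h⟩⟩

theorem dir_iff (h : IsCount s G₀ f C) {a b : V} (hab : G₀.dir a b) : C.dir a b ↔ f a = f b := by
  rcases h.2 a b hab with ⟨h1, h2⟩ | ⟨h1, h2⟩
  · simp [h1, h2]
  · simp [C.not_dir_symm h2, h1]

theorem dir_symm_iff (h : IsCount s G₀ f C) {a b : V} (hab : G₀.dir a b) :
    C.dir b a ↔ f b = f a + 1 := by
  rcases h.2 a b hab with ⟨h1, h2⟩ | ⟨h1, h2⟩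
  · simp [C.not_dir_symm h2, h1]
  · simp [h1, h2]

theorem config_unique (hC : IsCount s G₀ f C) (hD : IsCount s G₀ f D) : C = D := by
  refine Orientation.ext_dir fun a b => ?_
  by_cases hab : G.Adj a b
  · rcases G₀.dir_or_dir hab with h | h
    · rw [hC.dir_iff h, hD.dir_iff h]
    · rw [hC.dir_symm_iff h, hD.dir_symm_iff h]
  · exact iff_of_false (fun h => hab (C.adj_of_dir h)) (fun h => hab (D.adj_of_dir h))

theorem count_unique (hG : G.Connected) (hf : IsCount s G₀ f C) (hg : IsCount s G₀ g C) :
    f = g := by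
  funext v
  obtain ⟨w⟩ := hG.preconnected v s
  induction w with
  | nil => rw [hf.1, hg.1]
  | @cons u v _ huv _ ih =>
    have ih := ih hf hg
    rcases G₀.dir_or_dir huv with h | h
    · have h1 := hf.dir_iff h
      have h2 := hg.dir_iff h
      have h3 := hf.2 _ _ h
      have h4 := hg.2 _ _ h
      grind
    · have h1 := hf.dir_iff h
      have h2 := hg.dir_iff h
      have h3 := hf.2 _ _ h
      have h4 := hg.2 _ _ h
      grind

theorem le_length (hf : IsCount s G₀ f C) {v : V} (w : G.Walk v s) : f v ≤ w.length := by
  induction w with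
  | nil => simp [hf.1]
  | @cons u v _ huv _ ih =>
    have ih := ih hf
    rw [SimpleGraph.Walk.length_cons]
    rcases G₀.dir_or_dir huv with h | h
    · have := hf.2 _ _ h
      omega
    · have := hf.2 _ _ h
      omega

theorem lt_card [Fintype V] (hG : G.Connected) (hf : IsCount s G₀ f C) (v : V) :
    f v < Fintype.card V := by
  obtain ⟨w, hw⟩ := hG.preconnected.exists_isPath v s
  exact (hf.le_length w).trans_lt hw.length_lt

theorem fires [DecidableEq V] {v : V} (hf : IsCount s G₀ f C) (h : Fires s C v D) :
    IsCount s G₀ (Function.update f v (f v + 1)) D := by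
  obtain ⟨⟨hs, hin⟩, h1, h2⟩ := h
  refine ⟨by simp [Function.update_of_ne hs.symm, hf.1], fun a b hab => ?_⟩
  have hne : a ≠ b := (G₀.adj_of_dir hab).ne
  have hadj := G₀.adj_of_dir hab
  by_cases ha : a = v
  · subst ha
    have h3 := hin b hadj.symm
    have h4 := (hf.dir_symm_iff hab).1 h3
    left
    simp [Function.update_of_ne hne.symm, h4, h1, h3]
  · by_cases hb : b = v
    · subst hb
      have h3 := hin a hadj
      have h4 := (hf.dir_iff hab).1 h3
      right
      simp [Function.update_of_ne hne, h4, h1, h3]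
    · rw [Function.update_of_ne ha, Function.update_of_ne hb, h2 _ _ ha hb, h2 _ _ hb ha]
      exact hf.2 _ _ hab

theorem fireSeq [BEq V] [LawfulBEq V] {l : List V} (hf : IsCount s G₀ f C) (h : FireSeq s C l D) :
    IsCount s G₀ (fun v => f v + l.count v) D := by
  classical
  induction h generalizing f with
  | nil => simpa using hf
  | @cons _ _ _ v l h _ ih =>
    convert ih (hf.fires h) using 2 with u
    by_cases huv : u = v
    · subst huv
      simp
      omega
    · simp [Function.update_of_ne huv, List.count_cons_of_ne (Ne.symm huv)]

end IsCount

/-- If `B` is a bisimulation between two games (up to firing sequences) that relates the initial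
configurations and is one-to-one, then the configuration spaces are isomorphic. -/
theorem nonempty_orderIso_of_bisimulation {W : Type*} {G : SimpleGraph V} {H : SimpleGraph W}
    {s : V} {t : W} {G₀ : Orientation G} {H₀ : Orientation H}
    (B : Orientation G → Orientation H → Prop) (h₀ : B G₀ H₀)
    (hleft : ∀ C C' D, B C D → B C' D → C = C')
    (hright : ∀ C D D', B C D → B C D' → D = D')
    (hforth : ∀ C D v C', B C D → Fires s C v C' → ∃ w D', Fires t D w D' ∧ B C' D')
    (hback : ∀ C D w D', B C D → Fires t D w D' → ∃ v C', Fires s C v C' ∧ B C' D') :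
    Nonempty (ConfigSpace G s G₀ ≃o ConfigSpace H t H₀) := by
  have forth : ∀ C l C', FireSeq s C l C' → ∀ D, B C D →
      ∃ m D', FireSeq t D m D' ∧ B C' D' := by
    intro C l C' h
    induction h with
    | nil => exact fun D hD => ⟨[], D, .nil _, hD⟩
    | cons hv _ ih =>
      intro D hD
      obtain ⟨w, D', hw, hD'⟩ := hforth _ _ _ _ hD hv
      obtain ⟨m, D'', hm, hD''⟩ := ih D' hD'
      exact ⟨w :: m, D'', .cons hw hm, hD''⟩
  have back : ∀ D m D', FireSeq t D m D' → ∀ C, B C D →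
      ∃ l C', FireSeq s C l C' ∧ B C' D' := by
    intro D m D' h
    induction h with
    | nil => exact fun C hC => ⟨[], C, .nil _, hC⟩
    | cons hw _ ih =>
      intro C hC
      obtain ⟨v, C', hv, hC'⟩ := hback _ _ _ _ hC hw
      obtain ⟨l, C'', hl, hC''⟩ := ih C' hC'
      exact ⟨v :: l, C'', .cons hv hl, hC''⟩
  have toRight : ∀ C : ConfigSpace G s G₀, ∃ D : ConfigSpace H t H₀, B C.1 D.1 := by
    rintro ⟨C, l, hl⟩
    obtain ⟨m, D, hm, hD⟩ := forth _ _ _ hl _ h₀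
    exact ⟨⟨D, m, hm⟩, hD⟩
  have toLeft : ∀ D : ConfigSpace H t H₀, ∃ C : ConfigSpace G s G₀, B C.1 D.1 := by
    rintro ⟨D, m, hm⟩
    obtain ⟨l, C, hl, hC⟩ := back _ _ _ hm _ h₀
    exact ⟨⟨C, l, hl⟩, hC⟩
  choose φ hφ using toRight
  choose ψ hψ using toLeft
  refine ⟨⟨⟨φ, ψ, fun C => Subtype.ext (hleft _ _ _ (hψ _) (hφ C)),
    fun D => Subtype.ext (hright _ _ _ (hφ _) (hψ D))⟩, ?_⟩⟩
  intro C C'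
  constructor
  · rintro ⟨m, hm⟩
    obtain ⟨l, E, hl, hE⟩ := back _ _ _ hm _ (hφ C')
    exact ⟨l, hleft _ _ _ hE (hφ C) ▸ hl⟩
  · rintro ⟨l, hl⟩
    obtain ⟨m, E, hm, hE⟩ := forth _ _ _ hl _ (hφ C')
    exact ⟨m, hright _ _ _ hE (hφ C) ▸ hm⟩

section Unfolding

variable {G : SimpleGraph V}

/-- The initial arcs of the unfolded game. Its vertices are a sink `none` and the events
`some (v, i)`, standing for the firing of `v` when it has already been fired `i` times;
an arc between events goes to an event from one that requires it. -/
def unfoldDir (s : V) (G₀ : Orientation G) (N : ℕ) :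
    Option (V × Fin N) → Option (V × Fin N) → Prop
  | none, none => False
  | none, some (v, _) => v ≠ s
  | some (v, _), none => v = s
  | some (v, i), some (u, j) =>
    (u = v ∧ j.1 + 1 = i.1) ∨ (G₀.dir u v ∧ j.1 + 1 = i.1) ∨ (G₀.dir v u ∧ j.1 = i.1)

theorem unfoldDir_asymm (s : V) (G₀ : Orientation G) (N : ℕ) {a b : Option (V × Fin N)}
    (hab : unfoldDir s G₀ N a b) : ¬ unfoldDir s G₀ N b a := by
  rcases a with _ | ⟨v, i⟩ <;> rcases b with _ | ⟨u, j⟩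
  · exact hab.elim
  · exact hab
  · exact fun h => h hab
  · have h1 := fun h => G₀.not_dir_symm (a := u) (b := v) h
    simp only [unfoldDir] at hab ⊢
    rintro (h | h | h) <;> rcases hab with h' | h' | h' <;> first | omega | tauto

/-- The graph of the unfolded game. -/
def unfoldGraph (s : V) (G₀ : Orientation G) (N : ℕ) : SimpleGraph (Option (V × Fin N)) where
  Adj a b := unfoldDir s G₀ N a b ∨ unfoldDir s G₀ N b a
  symm := ⟨fun _ _ h => h.symm⟩
  loopless := ⟨fun _ h => unfoldDir_asymm s G₀ N (h.elim id id) (h.elim id id)⟩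

/-- The initial configuration of the unfolded game. -/
def unfoldInit (s : V) (G₀ : Orientation G) (N : ℕ) : Orientation (unfoldGraph s G₀ N) where
  dir := unfoldDir s G₀ N
  adj_of_dir _ _ h := Or.inl h
  dir_iff_not _ _ h := ⟨unfoldDir_asymm s G₀ N, fun h' => h.resolve_right h'⟩

theorem unfoldGraph_connected (s : V) (G₀ : Orientation G) (N : ℕ) :
    (unfoldGraph s G₀ N).Connected := by
  have h : ∀ a, (unfoldGraph s G₀ N).Reachable none a := by
    rintro (_ | ⟨v, i⟩)
    · exact .refl _
    · refine SimpleGraph.Adj.reachable ?_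
      by_cases hv : v = s
      · exact Or.inr hv
      · exact Or.inl hv
  exact (SimpleGraph.connected_iff _).2 ⟨fun a b => (h a).symm.trans (h b), ⟨none⟩⟩

theorem IsCount.unfold_le_one {s : V} {G₀ : Orientation G} {N : ℕ} {g : Option (V × Fin N) → ℕ}
    {D : Orientation (unfoldGraph s G₀ N)} (hg : IsCount none (unfoldInit s G₀ N) g D)
    (a : Option (V × Fin N)) : g a ≤ 1 := by
  have h0 := hg.1
  rcases a with _ | ⟨v, i⟩
  · omega
  · by_cases hv : v = s
    · have := hg.2 (some (v, i)) none hv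
      omega
    · have := hg.2 none (some (v, i)) hv
      omega

theorem unfold_isSimple (s : V) (G₀ : Orientation G) (N : ℕ) :
    IsSimple none (unfoldInit s G₀ N) := by
  classical
  intro l C h
  refine List.nodup_iff_count_le_one.2 fun a => ?_
  simpa using ((IsCount.zero _ _).fireSeq h).unfold_le_one a

/-- Firing counts `f` of a game correspond to firing counts `g` of its unfolding. -/
def CountRel {N : ℕ} (f : V → ℕ) (g : Option (V × Fin N) → ℕ) : Prop :=
  g none = 0 ∧ ∀ v (i : Fin N), g (some (v, i)) = if i.1 < f v then 1 else 0

namespace CountRel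

variable {s : V} {G₀ C : Orientation G} {N : ℕ} {f f' : V → ℕ} {g g' : Option (V × Fin N) → ℕ}
  {D : Orientation (unfoldGraph s G₀ N)}

theorem right_unique (h : CountRel f g) (h' : CountRel f g') : g = g' := by
  funext a
  rcases a with _ | ⟨v, i⟩
  · rw [h.1, h'.1]
  · rw [h.2, h'.2]

theorem left_unique (h : CountRel f g) (h' : CountRel f' g) (hf : ∀ v, f v < N)
    (hf' : ∀ v, f' v < N) : f = f' := by
  funext v
  have h1 := (h.2 v ⟨f v, hf v⟩).symm.trans (h'.2 v ⟨f v, hf v⟩)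
  have h2 := (h.2 v ⟨f' v, hf' v⟩).symm.trans (h'.2 v ⟨f' v, hf' v⟩)
  simp only at h1 h2
  split_ifs at h1 h2 <;> omega

theorem update [DecidableEq V] (h : CountRel f g) (v : V) (hv : f v < N) :
    CountRel (Function.update f v (f v + 1))
      (Function.update g (some (v, ⟨f v, hv⟩)) (g (some (v, ⟨f v, hv⟩)) + 1)) := by
  refine ⟨by simp [h.1], fun u j => ?_⟩
  by_cases huv : u = v
  · subst huv
    by_cases hj : j = ⟨f u, hv⟩
    · subst hj
      simp [h.2]
    · have hj' : j.1 ≠ f u := fun e => hj (Fin.ext e)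
      rw [Function.update_of_ne (by simpa using hj), h.2, Function.update_self]
      split_ifs <;> omega
  · rw [Function.update_of_ne (by simp [huv]), h.2, Function.update_of_ne huv]

theorem firable_unfold (h : CountRel f g) (hf : IsCount s G₀ f C)
    (hg : IsCount none (unfoldInit s G₀ N) g D) {v : V} (hv : f v < N) (hC : Firable s C v) :
    Firable none D (some (v, ⟨f v, hv⟩)) := by
  obtain ⟨hvs, hin⟩ := hC
  have hgv : g (some (v, ⟨f v, hv⟩)) = 0 := by simp [h.2]
  have hto : ∀ u, G₀.dir u v → f u = f v := fun u hu =>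
    (hf.dir_iff hu).1 (hin u (G₀.adj_of_dir hu))
  have hfrom : ∀ u, G₀.dir v u → f u = f v + 1 := fun u hu =>
    (hf.dir_symm_iff hu).1 (hin u (G₀.adj_of_dir hu).symm)
  refine ⟨by simp, ?_⟩
  rintro (_ | ⟨u, j⟩) hadj
  · exact (hg.dir_iff (a := none) (b := some (v, _)) hvs).2 (by rw [h.1, hgv])
  · rcases hadj with hd | hd
    · refine (hg.dir_iff (a := some (u, j)) (b := some (v, _)) hd).2 ?_
      rw [hgv, h.2, if_neg]
      rcases hd with ⟨rfl, e⟩ | ⟨e', e⟩ | ⟨e', e⟩ <;> simp only at e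
      · omega
      · have := hfrom u e'
        omega
      · have := hto u e'
        omega
    · refine (hg.dir_symm_iff (a := some (v, _)) (b := some (u, j)) hd).2 ?_
      rw [hgv, h.2, if_pos]
      rcases hd with ⟨rfl, e⟩ | ⟨e', e⟩ | ⟨e', e⟩ <;> simp only at e
      · omega
      · have := hto u e'
        omega
      · have := hfrom u e'
        omega

theorem firable_of_unfold (h : CountRel f g) (hf : IsCount s G₀ f C)
    (hg : IsCount none (unfoldInit s G₀ N) g D) {v : V} {i : Fin N}
    (hD : Firable none D (some (v, i))) : i.1 = f v ∧ Firable s C v := by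
  obtain ⟨-, hin⟩ := hD
  have hvs : v ≠ s := by
    intro hv
    have hd : (unfoldInit s G₀ N).dir (some (v, i)) none := hv
    have := (hg.dir_symm_iff hd).1 (hin none (Or.inr hd))
    rw [h.1] at this
    omega
  have hgv : g (some (v, i)) = 0 := by
    have hd : (unfoldInit s G₀ N).dir none (some (v, i)) := hvs
    have := (hg.dir_iff hd).1 (hin none (Or.inl hd))
    rw [← this, h.1]
  have hle : f v ≤ i.1 := by
    rw [h.2] at hgv
    split_ifs at hgv with hlt
    omega
  have hreq : ∀ u j, unfoldDir s G₀ N (some (v, i)) (some (u, j)) → j.1 < f u := by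
    intro u j hd
    have := (hg.dir_symm_iff (a := some (v, i)) (b := some (u, j)) hd).1 (hin _ (Or.inr hd))
    rw [hgv, h.2] at this
    by_contra hn
    simp [hn] at this
  have hi : i.1 = f v := by
    by_contra hne
    have := hreq v ⟨i.1 - 1, by omega⟩ (Or.inl ⟨rfl, by simp only; omega⟩)
    simp only at this
    omega
  refine ⟨hi, hvs, fun u hu => ?_⟩
  rcases G₀.dir_or_dir hu with hd | hd
  · rcases hf.2 _ _ hd with h1 | h1
    · exact h1.2
    · have := hreq u ⟨i.1 - 1, by omega⟩ (Or.inr (Or.inl ⟨hd, by simp only; omega⟩))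
      simp only at this
      omega
  · rcases hf.2 _ _ hd with h1 | h1
    · have := hreq u i (Or.inr (Or.inr ⟨hd, rfl⟩))
      omega
    · exact h1.2

end CountRel

end Unfolding

/-- the configuration space of any EFG is order-isomorphic to the
configuration space of some simple EFG. -/
theorem any_EFG_equivalent_to_a_simple_one
    {V : Type} [Fintype V] (G : SimpleGraph V) (hconn : G.Connected)
    (s : V) (G₀ : Orientation G) :
    ∃ (V' : Type) (_ : Fintype V') (G' : SimpleGraph V') (s' : V') (G₀' : Orientation G'),
      G'.Connected ∧ IsSimple s' G₀' ∧
        Nonempty (ConfigSpace G s G₀ ≃o ConfigSpace G' s' G₀') := by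
  classical
  have hconn' := unfoldGraph_connected s G₀ (Fintype.card V)
  refine ⟨Option (V × Fin (Fintype.card V)), inferInstance, unfoldGraph s G₀ _, none,
    unfoldInit s G₀ _, hconn', unfold_isSimple s G₀ _, ?_⟩
  refine nonempty_orderIso_of_bisimulation (fun C D => ∃ f g, IsCount s G₀ f C ∧
    IsCount none (unfoldInit s G₀ _) g D ∧ CountRel f g) ?_ ?_ ?_ ?_ ?_
  · exact ⟨0, 0, .zero _ _, .zero _ _, rfl, by simp⟩
  · rintro C C' D ⟨f, g, hf, hg, h⟩ ⟨f', g', hf', hg', h'⟩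
    obtain rfl := hg.count_unique hconn' hg'
    obtain rfl := h.left_unique h' (hf.lt_card hconn) (hf'.lt_card hconn)
    exact hf.config_unique hf'
  · rintro C D D' ⟨f, g, hf, hg, h⟩ ⟨f', g', hf', hg', h'⟩
    obtain rfl := hf.count_unique hconn hf'
    obtain rfl := h.right_unique h'
    exact hg.config_unique hg'
  · rintro C D v C' ⟨f, g, hf, hg, h⟩ hv
    have hlt := hf.lt_card hconn v
    have hw := (h.firable_unfold hf hg hlt hv.1).fires_reverseAt
    exact ⟨_, _, hw, _, _, hf.fires hv, hg.fires hw, h.update v hlt⟩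
  · rintro C D (_ | ⟨v, i, hi⟩) D' ⟨f, g, hf, hg, h⟩ hw
    · exact absurd rfl hw.1.1
    · obtain ⟨e, hv⟩ := h.firable_of_unfold hf hg hw.1
      simp only at e
      subst e
      exact ⟨_, _, hv.fires_reverseAt, _, _, hf.fires hv.fires_reverseAt, hg.fires hw,
        h.update v hi⟩

end EFG
end
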